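/- Let P ⊆ ℝ³ be a full-dimensional strictly bipartite convex polytope with radii r1 < r2. Then P has an edge in-sphere: there exists ρ with 0 < ρ < r1 such that for every edge e of P the distance from the origin to the closed segment e equals ρ (i.e. inf_{x ∈ e} ‖x‖ = ρ). -/

import Mathlib

open Set Pointwise

noncomputable section

/-- Euclidean space `ℝ^d`. -/
abbrev Euc (d : ℕ) := EuclideanSpace ℝ (Fin d)

/-- A convex polytope: the convex hull of a finite set of points. -/
def IsPolytope {d : ℕ} (P : Set (Euc d)) : Prop :=
  ∃ S : Finset (Euc d), P = convexHull ℝ (S : Set (Euc d))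

/-- `P` is full-dimensional: its affine span is all of `ℝ^d`. -/
def FullDim {d : ℕ} (P : Set (Euc d)) : Prop :=
  affineSpan ℝ P = ⊤

/-- `[v,w]` is an edge of `P`: an exposed face of `P` which is a segment with `v ≠ w`. -/
def IsEdge {d : ℕ} (P : Set (Euc d)) (v w : Euc d) : Prop :=
  v ≠ w ∧ IsExposed ℝ P (segment ℝ v w)

/-- `e` is an edge of `P`, as a set. -/
def IsEdgeSet {d : ℕ} (P e : Set (Euc d)) : Prop :=
  ∃ v w : Euc d, IsEdge P v w ∧ e = segment ℝ v w

/-- `T` is a symmetry of `P`: a linear isometry mapping `P` onto itself. -/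
def IsAut {d : ℕ} (P : Set (Euc d)) (T : Euc d ≃ₗᵢ[ℝ] Euc d) : Prop :=
  T '' P = P

/-- `P` is vertex-transitive: any vertex (extreme point) can be mapped onto any
other by a symmetry of `P`. -/
def VertexTransitive {d : ℕ} (P : Set (Euc d)) : Prop :=
  ∀ v ∈ Set.extremePoints ℝ P, ∀ w ∈ Set.extremePoints ℝ P,
    ∃ T : Euc d ≃ₗᵢ[ℝ] Euc d, IsAut P T ∧ T v = w

/-- `P` is edge-transitive: any edge can be mapped onto any other by a symmetry of `P`. -/
def EdgeTransitive {d : ℕ} (P : Set (Euc d)) : Prop :=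
  ∀ e e' : Set (Euc d), IsEdgeSet P e → IsEdgeSet P e' →
    ∃ T : Euc d ≃ₗᵢ[ℝ] Euc d, IsAut P T ∧ T '' e = e'

/-- `P` is bipartite with vertex partition `V1, V2`, radii `r1 ≤ r2` and edge length `ℓ`:
all edges have length `ℓ`, every edge joins `V1` to `V2`, where `V1 ⊔ V2` is a partition of
the vertex set, and vertices in `Vᵢ` have norm `rᵢ`. -/
def IsBipartiteWith {d : ℕ} (P V1 V2 : Set (Euc d)) (r1 r2 ℓ : ℝ) : Prop :=
  (0 < ℓ) ∧ (∀ v w : Euc d, IsEdge P v w → ‖v - w‖ = ℓ) ∧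
  (V1 ∪ V2 = Set.extremePoints ℝ P) ∧ Disjoint V1 V2 ∧
  (∀ v w : Euc d, IsEdge P v w → (v ∈ V1 ∧ w ∈ V2) ∨ (v ∈ V2 ∧ w ∈ V1)) ∧
  (0 < r1) ∧ (r1 ≤ r2) ∧ (∀ v ∈ V1, ‖v‖ = r1) ∧ (∀ v ∈ V2, ‖v‖ = r2)

/-- `P` is a bipartite polytope. -/
def IsBipartite {d : ℕ} (P : Set (Euc d)) : Prop :=
  ∃ (V1 V2 : Set (Euc d)) (r1 r2 ℓ : ℝ), IsBipartiteWith P V1 V2 r1 r2 ℓ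

/-- `P` is a strictly bipartite polytope (`r1 < r2`). -/
def IsStrictlyBipartite {d : ℕ} (P : Set (Euc d)) : Prop :=
  ∃ (V1 V2 : Set (Euc d)) (r1 r2 ℓ : ℝ), IsBipartiteWith P V1 V2 r1 r2 ℓ ∧ r1 < r2

/-- An extreme point of the convex hull of a finite set is strictly separated from the
other points of the set by a linear functional. -/
theorem exists_forall_lt_of_mem_extremePoints_convexHull {E : Type*} [NormedAddCommGroup E]
    [NormedSpace ℝ E] {T : Set E} (hT : T.Finite) {p : E}
    (hp : p ∈ (convexHull ℝ T).extremePoints ℝ) :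
    ∃ h : E →L[ℝ] ℝ, ∀ t ∈ T, t ≠ p → h t < h p := by
  have hp' : p ∉ convexHull ℝ (T \ {p}) := fun hmem =>
    (((convex_convexHull ℝ T).mem_extremePoints_iff_mem_sdiff_convexHull_sdiff).1 hp).2
      (convexHull_mono (sdiff_subset_sdiff_left (subset_convexHull ℝ T)) hmem)
  obtain ⟨h, u, h1, h2⟩ := geometric_hahn_banach_closed_point (convex_convexHull ℝ (T \ {p}))
    ((hT.subset sdiff_subset).isClosed_convexHull ℝ) hp'
  exact ⟨h, fun t ht htp => (h1 t (subset_convexHull ℝ _ ⟨ht, htp⟩)).trans h2⟩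

/-- A linear functional that is somewhere negative on the convex hull of a finite set is
negative at one of its extreme points. -/
theorem exists_mem_extremePoints_convexHull_neg {E : Type*} [NormedAddCommGroup E]
    [NormedSpace ℝ E] {T : Set E} (hT : T.Finite) (f : E →L[ℝ] ℝ) {x : E} (hx : x ∈ T)
    (hfx : f x < 0) : ∃ q ∈ (convexHull ℝ T).extremePoints ℝ, f q < 0 := by
  by_contra! hcon
  have hsub : closure (convexHull ℝ ((convexHull ℝ T).extremePoints ℝ)) ⊆ {y | 0 ≤ f y} :=
    closure_minimal (convexHull_min hcon (convex_halfSpace_ge f.isLinear 0))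
      (isClosed_le continuous_const f.continuous)
  rw [closure_convexHull_extremePoints (hT.isCompact_convexHull ℝ) (convex_convexHull ℝ T)] at hsub
  exact absurd (hsub (subset_convexHull ℝ T hx)) (not_le.2 hfx)

/-- If `H` is maximised over a finite set `S` at `v ∈ S`, and all maximisers in `S` lie on the
segment from `v` to `w ∈ S`, where `H w = H v`, then this segment is an exposed face of the
convex hull of `S`. -/
theorem isExposed_segment_convexHull {E : Type*} [NormedAddCommGroup E] [NormedSpace ℝ E]
    {S : Set E} {v w : E} (hv : v ∈ S) (hw : w ∈ S) (H : E →L[ℝ] ℝ) (hHw : H w = H v)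
    (hS : ∀ s ∈ S, H s < H v ∨ s ∈ segment ℝ v w) :
    IsExposed ℝ (convexHull ℝ S) (segment ℝ v w) := by
  intro _
  have hseg : ∀ x ∈ segment ℝ v w, H x = H v := by
    rintro x ⟨a, b, -, -, hab, rfl⟩
    simp only [map_add, map_smul, smul_eq_mul, hHw]
    rw [← add_mul, hab, one_mul]
  have hle : ∀ x, H x < H v ∨ x ∈ segment ℝ v w → H x ≤ H v := by
    rintro x (hx | hx)
    · exact hx.le
    · exact (hseg x hx).le
  have hconv : Convex ℝ {x | H x < H v ∨ x ∈ segment ℝ v w} := by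
    rw [convex_iff_forall_pos]
    intro x hx y hy a b ha hb hab
    by_cases hxy : x ∈ segment ℝ v w ∧ y ∈ segment ℝ v w
    · exact Or.inr ((convex_segment v w) hxy.1 hxy.2 ha.le hb.le hab)
    · left
      have h1 := hle x hx
      have h2 := hle y hy
      have hvab : H v = a * H v + b * H v := by rw [← add_mul, hab, one_mul]
      simp only [map_add, map_smul, smul_eq_mul]
      rcases hx with hx | hx
      · have := mul_lt_mul_of_pos_left hx ha
        have := mul_le_mul_of_nonneg_left h2 hb.le
        linarith
      · rcases hy with hy | hy
        · have := mul_le_mul_of_nonneg_left h1 ha.le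
          have := mul_lt_mul_of_pos_left hy hb
          linarith
        · exact absurd ⟨hx, hy⟩ hxy
  have hsub := convexHull_min (s := S) hS hconv
  refine ⟨H, Subset.antisymm (fun x hx => ⟨?_, fun y hy => ?_⟩) ?_⟩
  · exact (convex_convexHull ℝ S).segment_subset (subset_convexHull ℝ S hv)
      (subset_convexHull ℝ S hw) hx
  · rw [hseg x hx]
    exact hle y (hsub hy)
  · rintro x ⟨hx, hmax⟩
    exact (hsub hx).resolve_left (not_lt.2 (hmax v (subset_convexHull ℝ S hv)))

/-- A polytope lies in the cone spanned by the edges at a vertex: a linear functional that does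
not decrease along the edges at the vertex `v` attains its minimum at `v`. -/
theorem le_of_forall_exposed_segment_le {E : Type*} [NormedAddCommGroup E] [NormedSpace ℝ E]
    {S : Set E} (hS : S.Finite) {v : E} (hv : v ∈ (convexHull ℝ S).extremePoints ℝ)
    (f : E →L[ℝ] ℝ)
    (hf : ∀ w, v ≠ w → IsExposed ℝ (convexHull ℝ S) (segment ℝ v w) → f v ≤ f w)
    {x : E} (hx : x ∈ convexHull ℝ S) : f v ≤ f x := by
  suffices hmin : ∀ s ∈ S, f v ≤ f s from
    convexHull_min (s := S) hmin (convex_halfSpace_ge f.isLinear (f v)) hx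
  by_contra! hcon
  obtain ⟨s₀, hs₀, hfs₀⟩ := hcon
  have hvS : v ∈ S := extremePoints_convexHull_subset hv
  obtain ⟨g, hg⟩ := exists_forall_lt_of_mem_extremePoints_convexHull hS hv
  -- the vertex figure, obtained by projecting `S` from `v` to the hyperplane `g = g v - 1`
  let q : E → E := fun s => (g v - g s)⁻¹ • (s - v)
  have hpos : ∀ s ∈ S, s ≠ v → 0 < g v - g s := fun s hs hsv => sub_pos.2 (hg s hs hsv)
  have hq : ∀ s ∈ S, s ≠ v → s - v = (g v - g s) • q s := fun s hs hsv =>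
    (smul_inv_smul₀ (hpos s hs hsv).ne' (s - v)).symm
  have hTfin : (q '' (S \ {v})).Finite := (hS.subset sdiff_subset).image q
  have hs₀v : s₀ ≠ v := by
    rintro rfl
    exact lt_irrefl _ hfs₀
  have hfq : f (q s₀) < 0 := by
    simp only [q, map_smul, map_sub, smul_eq_mul]
    exact mul_neg_of_pos_of_neg (inv_pos.2 (hpos s₀ hs₀ hs₀v)) (sub_neg.2 hfs₀)
  obtain ⟨p, hp, hfp⟩ := exists_mem_extremePoints_convexHull_neg hTfin f
    (mem_image_of_mem q ⟨hs₀, hs₀v⟩) hfq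
  obtain ⟨h, hh⟩ := exists_forall_lt_of_mem_extremePoints_convexHull hTfin hp
  obtain ⟨s₁, hs₁, hqs₁⟩ := extremePoints_convexHull_subset hp
  -- the point of `S` on the ray through `p` that is farthest from `v`
  obtain ⟨w, ⟨⟨hwS, hwv⟩, hqw⟩, hwmax⟩ :=
    Set.exists_min_image {s | s ∈ S \ {v} ∧ q s = p} g
      (hS.subset fun s hs => hs.1.1) ⟨s₁, hs₁, hqs₁⟩
  have hwp := hq w hwS hwv
  rw [hqw] at hwp
  let H : E →L[ℝ] ℝ := h + h p • g
  have hH : ∀ s ∈ S, s ≠ v → H s - H v = (g v - g s) * (h (q s) - h p) := by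
    intro s hs hsv
    have h1 := congrArg h (hq s hs hsv)
    simp only [map_sub, map_smul, smul_eq_mul] at h1
    simp only [H, add_apply, smul_apply, smul_eq_mul]
    linear_combination h1
  have hexp : IsExposed ℝ (convexHull ℝ S) (segment ℝ v w) := by
    refine isExposed_segment_convexHull hvS hwS H ?_ fun s hs => ?_
    · have := hH w hwS hwv
      rw [hqw, sub_self, mul_zero] at this
      linarith
    · rcases eq_or_ne s v with rfl | hsv
      · exact Or.inr (left_mem_segment ℝ s w)
      by_cases hsp : q s = p
      · right
        have hsw := hwmax s ⟨⟨hs, hsv⟩, hsp⟩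
        have hsp' := hq s hs hsv
        rw [hsp] at hsp'
        have hgw := hpos w hwS hwv
        rw [segment_eq_image']
        refine ⟨(g v - g s) / (g v - g w), ⟨by have := hpos s hs hsv; positivity, ?_⟩, ?_⟩
        · rw [div_le_one hgw]
          linarith
        · simp only
          rw [hwp, smul_smul, div_mul_cancel₀ _ hgw.ne', ← hsp', add_sub_cancel]
      · left
        have := mul_neg_of_pos_of_neg (hpos s hs hsv)
          (sub_neg.2 (hh (q s) (mem_image_of_mem q ⟨hs, hsv⟩) hsp))
        rw [← hH s hs hsv] at this
        linarith
  have h1 := hf w (Ne.symm hwv) hexp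
  have h2 := congrArg f hwp
  simp only [map_sub, map_smul, smul_eq_mul] at h2
  have := mul_neg_of_pos_of_neg (hpos w hwS hwv) hfp
  linarith

/-- A vertex of a full-dimensional polytope in `ℝ³` has at least two neighbours. -/
theorem exists_isEdge_ne {P : Set (Euc 3)} (hP : IsPolytope P) (hfull : FullDim P) {v : Euc 3}
    (hv : v ∈ P.extremePoints ℝ) (u : Euc 3) : ∃ w, IsEdge P v w ∧ w ≠ u := by
  by_contra! hcon
  obtain ⟨S, rfl⟩ := hP
  obtain ⟨y, hy, hy0⟩ : ∃ y ∈ (ℝ ∙ (u - v))ᗮ, y ≠ 0 := by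
    refine Submodule.exists_mem_ne_zero_of_ne_bot fun hbot => ?_
    have h1 := (ℝ ∙ (u - v)).finrank_add_finrank_orthogonal
    have h2 := finrank_span_le_card (R := ℝ) ({u - v} : Set (Euc 3))
    rw [hbot, finrank_bot, finrank_euclideanSpace_fin] at h1
    simp at h2
    omega
  have hyu : inner ℝ y (u - v) = 0 := by
    rw [real_inner_comm]
    exact (Submodule.mem_orthogonal_singleton_iff_inner_right).1 hy
  rw [inner_sub_right] at hyu
  have hconst : ∀ x ∈ convexHull ℝ (S : Set (Euc 3)), inner ℝ y x = inner ℝ y v := by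
    intro x hx
    have h1 := le_of_forall_exposed_segment_le S.finite_toSet hv (innerSL ℝ y)
      (fun w hvw hw => by
        rw [hcon w ⟨hvw, hw⟩]
        simp only [innerSL_apply_apply]
        linarith) hx
    have h2 := le_of_forall_exposed_segment_le S.finite_toSet hv (-innerSL ℝ y)
      (fun w hvw hw => by
        rw [hcon w ⟨hvw, hw⟩]
        simp only [neg_apply, innerSL_apply_apply]
        linarith) hx
    simp only [neg_apply, innerSL_apply_apply] at h1 h2
    linarith
  have htop : vectorSpan ℝ (convexHull ℝ (S : Set (Euc 3))) = ⊤ := by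
    rw [← direction_affineSpan, hfull, AffineSubspace.direction_top]
  have hle : vectorSpan ℝ (convexHull ℝ (S : Set (Euc 3))) ≤ (ℝ ∙ y)ᗮ := by
    refine Submodule.span_le.2 ?_
    rintro _ ⟨a, ha, b, hb, rfl⟩
    rw [SetLike.mem_coe, Submodule.mem_orthogonal_singleton_iff_inner_right]
    simp only [vsub_eq_sub, inner_sub_right]
    rw [hconst a ha, hconst b hb, sub_self]
  rw [htop] at hle
  exact hy0 (inner_self_eq_zero.1
    ((Submodule.mem_orthogonal_singleton_iff_inner_right).1 (hle (Submodule.mem_top (x := y)))))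

/-- The squared norm along a segment in terms of the norms of the end points and its length. -/
theorem norm_add_smul_sub_sq {E : Type*} [NormedAddCommGroup E] [InnerProductSpace ℝ E]
    (v w : E) (t : ℝ) :
    ‖v + t • (w - v)‖ ^ 2 =
      ‖v‖ ^ 2 + t * (‖w‖ ^ 2 - ‖v‖ ^ 2 - ‖v - w‖ ^ 2) + t ^ 2 * ‖v - w‖ ^ 2 := by
  have h2 := norm_sub_sq_real v w
  rw [norm_add_sq_real, norm_smul, mul_pow, Real.norm_eq_abs, sq_abs, norm_sub_rev w v,
    inner_smul_right, inner_sub_right, real_inner_self_eq_norm_sq]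
  linear_combination t * h2

/-- The distance of a segment from the origin is determined by the norms of its end points and
its length. -/
theorem infDist_zero_segment_le {E : Type*} [NormedAddCommGroup E] [InnerProductSpace ℝ E]
    {v w v' w' : E} (hv : ‖v‖ = ‖v'‖) (hw : ‖w‖ = ‖w'‖) (hvw : ‖v - w‖ = ‖v' - w'‖) :
    Metric.infDist 0 (segment ℝ v w) ≤ Metric.infDist 0 (segment ℝ v' w') := by
  refine (Metric.le_infDist ⟨v', left_mem_segment ℝ v' w'⟩).2 fun y hy => ?_
  rw [segment_eq_image'] at hy
  obtain ⟨t, ht, rfl⟩ := hy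
  have hmem : v + t • (w - v) ∈ segment ℝ v w := by
    rw [segment_eq_image']
    exact mem_image_of_mem _ ht
  refine (Metric.infDist_le_dist_of_mem hmem).trans_eq ?_
  rw [dist_zero_left, dist_zero_left,
    ← sq_eq_sq₀ (norm_nonneg _) (norm_nonneg _), norm_add_smul_sub_sq, norm_add_smul_sub_sq,
    hv, hw, hvw]

/-- A segment that enters the ball around the origin through its end point `v` comes closer to
the origin than `v`. -/
theorem infDist_zero_segment_lt_norm {E : Type*} [NormedAddCommGroup E] [InnerProductSpace ℝ E]
    {v w : E} (h : ‖w‖ ^ 2 < ‖v‖ ^ 2 + ‖v - w‖ ^ 2) (hvw : ‖v‖ ≤ ‖w‖) (hne : v ≠ w) :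
    Metric.infDist 0 (segment ℝ v w) < ‖v‖ := by
  have hl : 0 < ‖v - w‖ ^ 2 := by
    have := norm_pos_iff.2 (sub_ne_zero.2 hne)
    positivity
  set t := (‖v‖ ^ 2 + ‖v - w‖ ^ 2 - ‖w‖ ^ 2) / (2 * ‖v - w‖ ^ 2) with ht
  have ht0 : 0 < t := div_pos (by linarith) (by linarith)
  have ht1 : t ≤ 1 := by
    rw [ht, div_le_one (by linarith)]
    have := pow_le_pow_left₀ (norm_nonneg v) hvw 2
    linarith
  have hmem : v + t • (w - v) ∈ segment ℝ v w := by
    rw [segment_eq_image']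
    exact mem_image_of_mem _ ⟨ht0.le, ht1⟩
  refine (Metric.infDist_le_dist_of_mem hmem).trans_lt ?_
  rw [dist_zero_left]
  refine lt_of_pow_lt_pow_left₀ 2 (norm_nonneg v) ?_
  rw [norm_add_smul_sub_sq]
  have h2 : t * (2 * ‖v - w‖ ^ 2) = ‖v‖ ^ 2 + ‖v - w‖ ^ 2 - ‖w‖ ^ 2 :=
    div_mul_cancel₀ _ (by linarith)
  have h3 : 0 < t ^ 2 * ‖v - w‖ ^ 2 := by positivity
  linear_combination h3 + t * h2

/-- If the segments from `v` to `w` and to `w'` have the same length, `‖w‖ = ‖w'‖`, and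
the first one contains the origin, then `w = w'`. -/
theorem eq_of_zero_mem_segment {E : Type*} [NormedAddCommGroup E] [InnerProductSpace ℝ E]
    {v w w' : E} (hv : v ≠ 0) (h0 : (0 : E) ∈ segment ℝ v w) (hw : ‖w‖ = ‖w'‖)
    (hvw : ‖v - w‖ = ‖v - w'‖) : w = w' := by
  obtain ⟨a, b, ha, hb, hab, h⟩ := h0
  have hb0 : b ≠ 0 := by
    rintro rfl
    rw [add_zero] at hab
    simp [hab, hv] at h
  obtain ⟨c, rfl⟩ : ∃ c : ℝ, w = c • v := by
    refine ⟨-(b⁻¹ * a), ?_⟩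
    rw [neg_smul, mul_smul, eq_neg_of_add_eq_zero_left h, smul_neg, neg_neg, inv_smul_smul₀ hb0]
  have h1 := norm_sub_sq_real v (c • v)
  have h2 := norm_sub_sq_real v w'
  rw [hvw, hw] at h1
  have h3 : inner ℝ v (c • v) = inner ℝ v w' := by linarith
  refine (sub_eq_zero.1 (norm_eq_zero.1 (pow_eq_zero_iff two_ne_zero |>.1 ?_)))
  rw [norm_sub_sq_real, ← hw, inner_smul_left]
  rw [inner_smul_right] at h3
  simp only [RCLike.conj_to_real]
  rw [← h3, norm_smul, mul_pow, Real.norm_eq_abs, sq_abs, real_inner_self_eq_norm_sq]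
  ring

/-- Edges are unoriented. -/
theorem IsEdge.symm {d : ℕ} {P : Set (Euc d)} {v w : Euc d} (h : IsEdge P v w) :
    IsEdge P w v :=
  ⟨h.1.symm, segment_symm ℝ v w ▸ h.2⟩

/-- A polytope is compact. -/
theorem IsPolytope.isCompact {d : ℕ} {P : Set (Euc d)} (hP : IsPolytope P) : IsCompact P := by
  obtain ⟨S, rfl⟩ := hP
  exact S.finite_toSet.isCompact_convexHull ℝ

/-- In a strictly bipartite polyhedron the angle between an edge and the radius at its inner
vertex is acute. -/
theorem IsBipartiteWith.sq_lt {P V1 V2 : Set (Euc 3)} {r1 r2 ℓ : ℝ}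
    (hP : IsPolytope P) (hfull : FullDim P) (hbip : IsBipartiteWith P V1 V2 r1 r2 ℓ)
    (hne : (P.extremePoints ℝ).Nonempty) : r2 ^ 2 < r1 ^ 2 + ℓ ^ 2 := by
  obtain ⟨-, hlen, hunion, hdisj, hedge, -, -, hV1, hV2⟩ := hbip
  have hnbr : ∀ v ∈ V1, ∀ w, IsEdge P v w → w ∈ V2 := fun v hv w hvw =>
    (hedge v w hvw).elim And.right fun h => absurd h.1 (disjoint_left.1 hdisj hv)
  have hnbr' : ∀ v ∈ V2, ∀ w, IsEdge P v w → w ∈ V1 := fun v hv w hvw =>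
    (hedge v w hvw).elim (fun h => absurd hv (disjoint_left.1 hdisj h.1)) And.right
  by_contra! hcon
  have hmin : ∀ v ∈ V1, ∀ x ∈ P, r1 ^ 2 ≤ inner ℝ v x := by
    intro v hv x hx
    have hvP : v ∈ P.extremePoints ℝ := hunion ▸ Or.inl hv
    obtain ⟨S, rfl⟩ := hP
    have h1 := le_of_forall_exposed_segment_le S.finite_toSet hvP (innerSL ℝ v)
      (fun w hvw hw => by
        have h2 := norm_sub_sq_real v w
        rw [hlen v w ⟨hvw, hw⟩, hV1 v hv, hV2 w (hnbr v hv w ⟨hvw, hw⟩)] at h2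
        simp only [innerSL_apply_apply]
        rw [real_inner_self_eq_norm_sq, hV1 v hv]
        linarith) hx
    simp only [innerSL_apply_apply] at h1
    rwa [real_inner_self_eq_norm_sq, hV1 v hv] at h1
  have hsub : ∀ v ∈ V1, ∀ w ∈ V1, v = w := by
    intro v hv w hw
    have hwP : w ∈ P.extremePoints ℝ := hunion ▸ Or.inl hw
    have h1 := hmin v hv w hwP.1
    have h2 := norm_sub_sq_real v w
    rw [hV1 v hv, hV1 w hw] at h2
    exact sub_eq_zero.1 (norm_eq_zero.1 (pow_eq_zero_iff two_ne_zero |>.1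
      (le_antisymm (by linarith) (sq_nonneg _))))
  obtain ⟨w, hw⟩ : V2.Nonempty := by
    obtain ⟨v, hv⟩ := hne
    obtain ⟨w, hvw, -⟩ := exists_isEdge_ne hP hfull hv v
    rcases hedge v w hvw with h | h
    · exact ⟨w, h.2⟩
    · exact ⟨v, h.1⟩
  have hwP : w ∈ P.extremePoints ℝ := hunion ▸ Or.inr hw
  obtain ⟨v, hwv, -⟩ := exists_isEdge_ne hP hfull hwP w
  obtain ⟨v', hwv', hvv'⟩ := exists_isEdge_ne hP hfull hwP v
  exact hvv' (hsub v' (hnbr' w hw v' hwv') v (hnbr' w hw v hwv))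

/-- A full-dimensional strictly bipartite polyhedron `P ⊆ ℝ³` with radii
`r1 < r2` has an edge in-sphere: there is `0 < ρ < r1` such that every edge of `P` has
distance exactly `ρ` from the origin. -/
theorem strictlyBipartite_has_edge_insphere
    (P V1 V2 : Set (Euc 3)) (r1 r2 ℓ : ℝ)
    (hP : IsPolytope P) (hfull : FullDim P)
    (hbip : IsBipartiteWith P V1 V2 r1 r2 ℓ) (hstrict : r1 < r2) :
    ∃ ρ : ℝ, 0 < ρ ∧ ρ < r1 ∧
      ∀ e : Set (Euc 3), IsEdgeSet P e → Metric.infDist 0 e = ρ := by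
  have hPne : P.Nonempty := by
    rw [← affineSpan_nonempty ℝ, hfull]
    exact AffineSubspace.top_coe ℝ (Euc 3) (Euc 3) ▸ univ_nonempty
  have hext : (P.extremePoints ℝ).Nonempty := hP.isCompact.extremePoints_nonempty hPne
  have hlt := hbip.sq_lt hP hfull hext
  obtain ⟨-, hlen, hunion, hdisj, hedge, hr1, -, hV1, hV2⟩ := hbip
  have horient : ∀ e, IsEdgeSet P e →
      ∃ v ∈ V1, ∃ w ∈ V2, IsEdge P v w ∧ e = segment ℝ v w := by
    rintro e ⟨v, w, hvw, rfl⟩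
    rcases hedge v w hvw with h | h
    · exact ⟨v, h.1, w, h.2, hvw, rfl⟩
    · exact ⟨w, h.2, v, h.1, hvw.symm, segment_symm ℝ v w⟩
  obtain ⟨x, hx⟩ := hext
  obtain ⟨y, hxy, -⟩ := exists_isEdge_ne hP hfull hx x
  obtain ⟨v, hv, w, hw, hvw, -⟩ := horient _ ⟨x, y, hxy, rfl⟩
  refine ⟨Metric.infDist 0 (segment ℝ v w), ?_, ?_, ?_⟩
  · have hclosed : IsClosed (segment ℝ v w) := by
      rw [← convexHull_pair]
      exact (toFinite {v, w}).isClosed_convexHull ℝ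
    refine (hclosed.notMem_iff_infDist_pos ⟨v, left_mem_segment ℝ v w⟩).1 fun h0 => ?_
    obtain ⟨w', hvw', hne⟩ := exists_isEdge_ne hP hfull (hunion.subset (Or.inl hv)) w
    have hw' : w' ∈ V2 := (hedge v w' hvw').elim And.right fun h =>
      absurd h.1 (disjoint_left.1 hdisj hv)
    have hv0 : v ≠ 0 := norm_pos_iff.1 ((hV1 v hv).symm ▸ hr1)
    exact hne (eq_of_zero_mem_segment hv0 h0 ((hV2 w hw).trans (hV2 w' hw').symm)
      ((hlen v w hvw).trans (hlen v w' hvw').symm)).symm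
  · rw [← hV1 v hv]
    refine infDist_zero_segment_lt_norm ?_ ?_ hvw.1
    · rwa [hlen v w hvw, hV1 v hv, hV2 w hw]
    · rw [hV1 v hv, hV2 w hw]
      exact hstrict.le
  · intro e he
    obtain ⟨v', hv', w', hw', hvw', rfl⟩ := horient e he
    have h1 := (hV1 v' hv').trans (hV1 v hv).symm
    have h2 := (hV2 w' hw').trans (hV2 w hw).symm
    have h3 := (hlen v' w' hvw').trans (hlen v w hvw).symm
    exact le_antisymm (infDist_zero_segment_le h1 h2 h3)
      (infDist_zero_segment_le h1.symm h2.symm h3.symm)
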